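/- Let p > 1. There exists a constant C > 0, depending only on p, α, β, a₀, δ, such that for all t ≥ 0 and x ∈ ℝⁿ, e^{(4/(p+1))ψ(t,x)} |∇ψ(t,x)|² ≤ C (1+t)^{−2(1+β)/(2−α)} (1+t)^{β + (1+β)α/(2−α)} e^{2ψ(t,x)} a(x) b(t). -/

import Mathlib

noncomputable section

open Real MeasureTheory Filter
open scoped RealInnerProductSpace ENNReal

abbrev E (n : ℕ) : Type := EuclideanSpace ℝ (Fin n)

/-- Japanese bracket `⟨x⟩ = (1+|x|²)^{1/2}`. -/
def jap {n : ℕ} (x : E n) : ℝ := Real.sqrt (1 + ‖x‖ ^ 2)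

/-- Space coefficient `a(x) = a₀ ⟨x⟩^{-α}`. -/
def aco {n : ℕ} (a₀ α : ℝ) (x : E n) : ℝ := a₀ * jap x ^ (-α)

/-- Time coefficient `b(t) = (1+t)^{-β}`. -/
def bco (β t : ℝ) : ℝ := (1 + t) ^ (-β)

/-- The constant `A = (1+β)a₀ / ((2-α)²(2+δ))`. -/
def Aco (a₀ α β δ : ℝ) : ℝ := (1 + β) * a₀ / ((2 - α) ^ 2 * (2 + δ))

/-- The weight `ψ(t,x) = A ⟨x⟩^{2-α}/(1+t)^{1+β}`. -/
def psiW {n : ℕ} (a₀ α β δ : ℝ) (t : ℝ) (x : E n) : ℝ :=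
  Aco a₀ α β δ * jap x ^ (2 - α) / (1 + t) ^ (1 + β)

/-- Laplacian of `f : ℝⁿ → ℝ` as the sum of second partial derivatives. -/
def lap {n : ℕ} (f : E n → ℝ) (x : E n) : ℝ :=
  ∑ i, fderiv ℝ (fun y => fderiv ℝ f y (EuclideanSpace.single i 1)) x (EuclideanSpace.single i 1)

/-- Divergence of a vector field on `ℝⁿ`. -/
def divg {n : ℕ} (V : E n → E n) (x : E n) : ℝ :=
  ∑ i, fderiv ℝ (fun y => V y i) x (EuclideanSpace.single i 1)

theorem jap_pos {n : ℕ} (x : E n) : 0 < jap x :=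
  Real.sqrt_pos.mpr (by positivity)

theorem norm_le_jap {n : ℕ} (x : E n) : ‖x‖ ≤ jap x :=
  Real.le_sqrt_of_sq_le (by linarith)

theorem jap_rpow {n : ℕ} (x : E n) (s : ℝ) : jap x ^ s = (1 + ‖x‖ ^ 2) ^ (s / 2) := by
  rw [jap, Real.sqrt_eq_rpow, ← Real.rpow_mul (by positivity)]
  congr 1
  ring

theorem hasFDerivAt_jap_rpow {n : ℕ} (s : ℝ) (x : E n) :
    HasFDerivAt (fun y : E n => jap y ^ s) ((s * jap x ^ (s - 2)) • innerSL ℝ x) x := by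
  have h := ((hasStrictFDerivAt_norm_sq x).hasFDerivAt.const_add 1).rpow_const (p := s / 2)
    (Or.inl (by positivity))
  simp only [jap_rpow]
  refine h.congr_fderiv ?_
  rw [← Nat.cast_smul_eq_nsmul ℝ, smul_smul]
  congr 1
  rw [show (s - 2) / 2 = s / 2 - 1 by ring]
  push_cast
  ring

theorem norm_gradient_psiW {n : ℕ} (a₀ α β δ t : ℝ) (x : E n) :
    ‖gradient (psiW a₀ α β δ t) x‖ =
      |Aco a₀ α β δ / (1 + t) ^ (1 + β) * ((2 - α) * jap x ^ (-α))| * ‖x‖ := by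
  have h : HasFDerivAt (psiW (n := n) a₀ α β δ t)
      ((Aco a₀ α β δ / (1 + t) ^ (1 + β) * ((2 - α) * jap x ^ (-α))) • innerSL ℝ x) x := by
    have h := (hasFDerivAt_jap_rpow (2 - α) x).const_mul (Aco a₀ α β δ / (1 + t) ^ (1 + β))
    rw [smul_smul, show 2 - α - 2 = -α by ring] at h
    refine h.congr_of_eventuallyEq (Eventually.of_forall fun y => ?_)
    simp only [psiW]
    ring
  rw [gradient, LinearIsometryEquiv.norm_map, h.fderiv, norm_smul, innerSL_apply_norm,
    Real.norm_eq_abs]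

theorem norm_sq_gradient_psiW_le {n : ℕ} {a₀ α β δ t : ℝ} (ht : 0 ≤ t) (x : E n) :
    ‖gradient (psiW a₀ α β δ t) x‖ ^ 2 ≤
      Aco a₀ α β δ * (2 - α) ^ 2 * psiW a₀ α β δ t x *
        (jap x ^ (-α) * (1 + t) ^ (-(1 + β))) := by
  have hJ := jap_pos x
  have hT : 0 < 1 + t := by linarith
  have hx : ‖x‖ ^ 2 ≤ jap x ^ 2 := by gcongr; exact norm_le_jap x
  have hJ2 : jap x ^ (2 - α) = jap x ^ 2 * jap x ^ (-α) := by
    rw [sub_eq_add_neg, Real.rpow_add hJ, Real.rpow_two]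
  rw [norm_gradient_psiW, mul_pow, sq_abs, psiW, hJ2, Real.rpow_neg hT.le]
  calc (Aco a₀ α β δ / (1 + t) ^ (1 + β) * ((2 - α) * jap x ^ (-α))) ^ 2 * ‖x‖ ^ 2
      ≤ (Aco a₀ α β δ / (1 + t) ^ (1 + β) * ((2 - α) * jap x ^ (-α))) ^ 2 * jap x ^ 2 := by
        gcongr
    _ = _ := by ring

/-- comparing `e^{(4/(p+1))ψ}|∇ψ|²` with `e^{2ψ} a(x) b(t)`. -/
theorem weight_gradient_comparison {n : ℕ} (hn : 1 ≤ n) (a₀ α β δ p : ℝ) (ha₀ : 0 < a₀)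
    (hα : 0 ≤ α) (hβ : 0 ≤ β) (hαβ : α + β < 1) (hδ : 0 < δ) (hp : 1 < p) :
    ∃ C > 0, ∀ t : ℝ, 0 ≤ t → ∀ x : E n,
      Real.exp ((4 / (p + 1)) * psiW a₀ α β δ t x) * ‖gradient (psiW a₀ α β δ t) x‖ ^ 2
        ≤ C * (1 + t) ^ (-(2 * (1 + β)) / (2 - α)) * (1 + t) ^ (β + (1 + β) * α / (2 - α)) *
            (Real.exp (2 * psiW a₀ α β δ t x) * (aco a₀ α x * bco β t)) := by
  have hα2 : 0 < 2 - α := by linarith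
  have hA : 0 < Aco a₀ α β δ := by unfold Aco; positivity
  have hc : 0 < 2 - 4 / (p + 1) := by
    rw [sub_pos, div_lt_iff₀ (by linarith)]
    linarith
  set c := 2 - 4 / (p + 1) with hc_def
  refine ⟨Aco a₀ α β δ * (2 - α) ^ 2 / (a₀ * c), by positivity, fun t ht x => ?_⟩
  have hT : 0 < 1 + t := by linarith
  have hJ := jap_pos x
  have hT_exp : (1 + t) ^ (-(2 * (1 + β)) / (2 - α)) *
      (1 + t) ^ (β + (1 + β) * α / (2 - α)) * (1 + t) ^ (-β) = (1 + t) ^ (-(1 + β)) := by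
    rw [← Real.rpow_add hT, ← Real.rpow_add hT]
    congr 1
    field_simp
    ring
  have hψ : psiW a₀ α β δ t x ≤ Real.exp (c * psiW a₀ α β δ t x) / c := by
    rw [le_div_iff₀ hc]
    linarith [Real.add_one_le_exp (c * psiW a₀ α β δ t x)]
  have hexp : Real.exp (2 * psiW a₀ α β δ t x) =
      Real.exp (4 / (p + 1) * psiW a₀ α β δ t x) * Real.exp (c * psiW a₀ α β δ t x) := by
    rw [← Real.exp_add, hc_def]
    congr 1
    ring
  calc Real.exp (4 / (p + 1) * psiW a₀ α β δ t x) * ‖gradient (psiW a₀ α β δ t) x‖ ^ 2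
      ≤ Real.exp (4 / (p + 1) * psiW a₀ α β δ t x) *
          (Aco a₀ α β δ * (2 - α) ^ 2 * psiW a₀ α β δ t x *
            (jap x ^ (-α) * (1 + t) ^ (-(1 + β)))) := by
        gcongr
        exact norm_sq_gradient_psiW_le ht x
    _ ≤ Real.exp (4 / (p + 1) * psiW a₀ α β δ t x) *
          (Aco a₀ α β δ * (2 - α) ^ 2 * (Real.exp (c * psiW a₀ α β δ t x) / c) *
            (jap x ^ (-α) * (1 + t) ^ (-(1 + β)))) := by
        gcongr
    _ = _ := by
        rw [hexp, ← hT_exp, aco, bco]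
        field_simp
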